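/- Let f, g : ℝ² → ℂ be integrable with compact support, and let V ⊆ ℝ be a nonempty open set of angles. Suppose that for every θ ∈ V and almost every s ∈ ℝ, the line integrals agree: ∫_ℝ f(s·θ⃗ + t·θ⃗⊥) dt = ∫_ℝ g(s·θ⃗ + t·θ⃗⊥) dt. Then f = g almost everywhere on ℝ². -/

import Mathlib

open MeasureTheory

lemma radon_int_mul (h : ℝ × ℝ → ℂ) (hint : Integrable h) (hs : HasCompactSupport h)
    (q : ℝ × ℝ → ℝ) (hq : Continuous q) : Integrable (fun p => q p • h p) := by
  rw [← integrableOn_iff_integrable_of_support_subset (s := tsupport h)]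
  · exact hint.integrableOn.continuousOn_smul hq.continuousOn hs
  · intro x hx
    apply subset_tsupport
    intro h0
    apply hx
    simp [h0]

lemma radon_exists_rot (θ : ℝ) : ∃ e : (ℝ × ℝ) ≃ᵐ (ℝ × ℝ), MeasurePreserving e ∧
    ∀ s t : ℝ, e (s, t) =
      (s * Real.cos θ - t * Real.sin θ, s * Real.sin θ + t * Real.cos θ) := by
  refine ⟨Complex.measurableEquivRealProd.symm.trans
    ((rotation (Circle.exp θ)).toMeasurableEquiv.trans Complex.measurableEquivRealProd), ?_, ?_⟩
  · exact (Complex.volume_preserving_equiv_real_prod.comp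
      (rotation (Circle.exp θ)).measurePreserving).comp
      (Complex.volume_preserving_equiv_real_prod.symm)
  · intro s t
    simp [Complex.measurableEquivRealProd_apply, Complex.exp_ofReal_mul_I_re,
      Complex.exp_ofReal_mul_I_im]
    constructor <;> ring

lemma radon_slice (h : ℝ × ℝ → ℂ) (hint : Integrable h) (hs : HasCompactSupport h) (θ : ℝ)
    (heq : ∀ᵐ s : ℝ,
      (∫ t : ℝ, h (s * Real.cos θ - t * Real.sin θ, s * Real.sin θ + t * Real.cos θ)) = 0)
    (n : ℕ) :
    ∫ p : ℝ × ℝ, (p.1 * Real.cos θ + p.2 * Real.sin θ) ^ n • h p = 0 := by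
  obtain ⟨e, he, hest⟩ := radon_exists_rot θ
  have hi := radon_int_mul h hint hs (fun p => (p.1 * Real.cos θ + p.2 * Real.sin θ) ^ n)
    (by fun_prop)
  rw [← he.integral_comp' (f := e)]
  have hi' := (he.integrable_comp_emb e.measurableEmbedding).2 hi
  rw [Measure.volume_eq_prod] at hi' ⊢
  simp only [Function.comp_def] at hi'
  rw [integral_prod _ hi']
  rw [integral_eq_zero_of_ae]
  filter_upwards [heq] with s hs
  have : ∀ t : ℝ, (((e (s, t)).1 * Real.cos θ + (e (s, t)).2 * Real.sin θ) ^ n • h (e (s, t)))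
      = s ^ n • h (s * Real.cos θ - t * Real.sin θ, s * Real.sin θ + t * Real.cos θ) := by
    intro t
    rw [hest]
    congr 2
    have := Real.sin_sq_add_cos_sq θ
    linear_combination s * this
  simp only [this, integral_smul, hs]
  simp

lemma radon_sub (f g : ℝ × ℝ → ℂ) (hf : Integrable f) (hg : Integrable g) (θ : ℝ)
    (heq : ∀ᵐ s : ℝ,
      (∫ t : ℝ, f (s * Real.cos θ - t * Real.sin θ, s * Real.sin θ + t * Real.cos θ))
      = ∫ t : ℝ, g (s * Real.cos θ - t * Real.sin θ, s * Real.sin θ + t * Real.cos θ)) :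
    ∀ᵐ s : ℝ, (∫ t : ℝ, (f - g)
      (s * Real.cos θ - t * Real.sin θ, s * Real.sin θ + t * Real.cos θ)) = 0 := by
  obtain ⟨e, he, hest⟩ := radon_exists_rot θ
  have hf' := (he.integrable_comp_emb e.measurableEmbedding).2 hf
  have hg' := (he.integrable_comp_emb e.measurableEmbedding).2 hg
  rw [Measure.volume_eq_prod] at hf' hg'
  filter_upwards [heq, hf'.prod_right_ae, hg'.prod_right_ae] with s h1 h2 h3
  simp only [Function.comp_def, hest] at h2 h3
  simp only [Pi.sub_apply]
  rw [integral_sub h2 h3, h1, sub_self]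

lemma radon_infinite (V : Set ℝ) (hV : IsOpen V) (hVne : V.Nonempty) :
    ∃ W ⊆ V, W.Infinite ∧ (∀ θ ∈ W, Real.cos θ ≠ 0) ∧ Set.InjOn Real.tan W := by
  have hW : IsOpen (V ∩ {θ | Real.cos θ ≠ 0}) :=
    hV.inter (isOpen_ne_fun Real.continuous_cos continuous_const)
  have hne : (V ∩ {θ | Real.cos θ ≠ 0}).Nonempty := by
    obtain ⟨a, ha⟩ := hVne
    by_cases hc : Real.cos a = 0
    · obtain ⟨ε, hε, hb⟩ := Metric.isOpen_iff.1 hV a ha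
      have hd : 0 < min (ε / 2) 1 := by positivity
      refine ⟨a + min (ε / 2) 1, hb ?_, ?_⟩
      · rw [Metric.mem_ball, Real.dist_eq, add_sub_cancel_left, abs_of_pos hd]
        linarith [min_le_left (ε / 2) 1]
      · have h1 : Real.sin (min (ε / 2) 1) ≠ 0 :=
          (Real.sin_pos_of_pos_of_lt_pi hd
            (by linarith [min_le_right (ε / 2) 1, Real.pi_gt_three])).ne'
        have h2 : Real.sin a ≠ 0 := by
          intro h0
          have := Real.sin_sq_add_cos_sq a
          simp [h0, hc] at this
        simp [Real.cos_add, hc, h1, h2]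
    · exact ⟨a, ha, hc⟩
  obtain ⟨a, ha⟩ := hne
  obtain ⟨ε, hε, hb⟩ := Metric.isOpen_iff.1 hW a ha
  have hd : 0 < min ε 1 := by positivity
  have hsub : Metric.ball a (min ε 1) ⊆ V ∩ {θ | Real.cos θ ≠ 0} :=
    (Metric.ball_subset_ball (min_le_left _ _)).trans hb
  refine ⟨Metric.ball a (min ε 1), fun x hx => (hsub hx).1, ?_, fun x hx => (hsub hx).2, ?_⟩
  · rw [Real.ball_eq_Ioo]
    exact Set.Ioo_infinite (by linarith)
  · intro x hx y hy hxy
    have hcx : Real.cos x ≠ 0 := (hsub hx).2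
    have hcy : Real.cos y ≠ 0 := (hsub hy).2
    rw [Real.tan_eq_sin_div_cos, Real.tan_eq_sin_div_cos, div_eq_div_iff hcx hcy] at hxy
    rw [Real.ball_eq_Ioo] at hx hy
    have h1 := min_le_right ε 1
    have hpi := Real.pi_gt_three
    have : Real.sin (x - y) = 0 := by rw [Real.sin_sub]; linarith
    rw [Real.sin_eq_zero_iff_of_lt_of_lt (by linarith [hx.1, hy.2]) (by linarith [hx.2, hy.1])]
      at this
    linarith

lemma radon_moments (h : ℝ × ℝ → ℂ) (hint : Integrable h) (hs : HasCompactSupport h)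
    (V : Set ℝ) (hV : IsOpen V) (hVne : V.Nonempty)
    (hz : ∀ θ ∈ V, ∀ n : ℕ,
      ∫ p : ℝ × ℝ, (p.1 * Real.cos θ + p.2 * Real.sin θ) ^ n • h p = 0) (a b : ℕ) :
    ∫ p : ℝ × ℝ, (p.1 ^ a * p.2 ^ b) • h p = 0 := by
  obtain ⟨W, hWV, hWi, hWc, hWt⟩ := radon_infinite V hV hVne
  let P : Polynomial ℂ := ∑ k ∈ Finset.range (a + b + 1), Polynomial.monomial k
    (((a + b).choose k : ℂ) * ∫ p : ℝ × ℝ, (p.1 ^ (a + b - k) * p.2 ^ k) • h p)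
  have hP : P = 0 := by
    apply Polynomial.eq_zero_of_infinite_isRoot
    refine ((hWi.image hWt).image Complex.ofReal_injective.injOn).mono ?_
    rintro _ ⟨_, ⟨θ, hθ, rfl⟩, rfl⟩
    have h1 := hz θ (hWV hθ) (a + b)
    have hc := hWc θ hθ
    have key : ∀ p : ℝ × ℝ, (p.1 * Real.cos θ + p.2 * Real.sin θ) ^ (a + b) • h p =
        ∑ k ∈ Finset.range (a + b + 1), (Real.cos θ ^ (a + b) *
          ((a + b).choose k * Real.tan θ ^ k)) • ((p.1 ^ (a + b - k) * p.2 ^ k) • h p) := by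
      intro p
      have : p.1 * Real.cos θ + p.2 * Real.sin θ =
        Real.cos θ * (p.2 * Real.tan θ + p.1) := by
        rw [← Real.tan_mul_cos hc]; ring
      rw [this, mul_pow, add_pow, Finset.mul_sum, Finset.sum_smul]
      refine Finset.sum_congr rfl fun k _ => ?_
      rw [smul_smul]
      congr 1
      ring
    simp only [key] at h1
    have hik : ∀ k ∈ Finset.range (a + b + 1), Integrable (fun p : ℝ × ℝ =>
        (Real.cos θ ^ (a + b) * ((a + b).choose k * Real.tan θ ^ k)) •
          ((p.1 ^ (a + b - k) * p.2 ^ k) • h p)) := fun k _ =>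
      (radon_int_mul h hint hs (fun p => p.1 ^ (a + b - k) * p.2 ^ k) (by fun_prop)).smul
        (Real.cos θ ^ (a + b) * ((a + b).choose k * Real.tan θ ^ k))
    rw [integral_finsetSum _ hik] at h1
    simp only [integral_smul, mul_smul, ← Finset.smul_sum] at h1
    have h2 := (smul_eq_zero.1 h1).resolve_left (pow_ne_zero _ hc)
    simp only [Set.mem_setOf_eq, Polynomial.IsRoot.def, P, Polynomial.eval_finset_sum,
      Polynomial.eval_monomial]
    rw [← h2]
    refine Finset.sum_congr rfl fun k _ => ?_
    simp only [Complex.real_smul, mul_smul]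
    push_cast
    ring
  have hco := congrArg (fun Q => Polynomial.coeff Q b) hP
  simp only [P, Polynomial.finsetSum_coeff, Polynomial.coeff_monomial, Polynomial.coeff_zero,
    Finset.sum_ite_eq', Finset.mem_range] at hco
  rw [if_pos (by omega)] at hco
  have h3 := (mul_eq_zero.1 hco).resolve_left
    (by exact_mod_cast (Nat.choose_pos (by omega : b ≤ a + b)).ne')
  simpa using h3

lemma radon_zero (h : ℝ × ℝ → ℂ) (hint : Integrable h) (hs : HasCompactSupport h)
    (hm : ∀ a b : ℕ, ∫ p : ℝ × ℝ, (p.1 ^ a * p.2 ^ b) • h p = 0) :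
    ∀ᵐ p, h p = 0 := by
  let X : C(ℝ × ℝ, ℝ) := ⟨Prod.fst, continuous_fst⟩
  let Y : C(ℝ × ℝ, ℝ) := ⟨Prod.snd, continuous_snd⟩
  let A : Subalgebra ℝ C(ℝ × ℝ, ℝ) := Algebra.adjoin ℝ {X, Y}
  have hA : ∀ q ∈ A, ∫ p, q p • h p = 0 := by
    intro q hq
    have hq' : q ∈ Submodule.span ℝ (Submonoid.closure {X, Y} : Set C(ℝ × ℝ, ℝ)) := by
      rw [← Algebra.adjoin_eq_span]; exact hq
    induction hq' using Submodule.span_induction with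
    | mem x hx =>
      obtain ⟨m, n, rfl⟩ := (Submonoid.mem_closure_pair _ _ _).1 hx
      exact hm m n
    | zero => simp
    | add x y hx hy h1 h2 =>
      have hx' : x ∈ A := by
        rw [← Algebra.adjoin_eq_span] at hx; exact hx
      have hy' : y ∈ A := by
        rw [← Algebra.adjoin_eq_span] at hy; exact hy
      simp only [ContinuousMap.add_apply, add_smul]
      rw [integral_add (radon_int_mul h hint hs x x.continuous)
        (radon_int_mul h hint hs y y.continuous), h1 hx', h2 hy', add_zero]
    | smul c x hx h1 =>
      have hx' : x ∈ A := by
        rw [← Algebra.adjoin_eq_span] at hx; exact hx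
      simp only [ContinuousMap.smul_apply, smul_assoc]
      rw [integral_smul, h1 hx', smul_zero]
  have hsep : A.SeparatesPoints := by
    intro p q hpq
    by_cases h1 : p.1 = q.1
    · exact ⟨Y, ⟨Y, Algebra.subset_adjoin (by simp), rfl⟩, fun h2 => hpq (Prod.ext h1 h2)⟩
    · exact ⟨X, ⟨X, Algebra.subset_adjoin (by simp), rfl⟩, h1⟩
  apply ae_eq_zero_of_integral_contDiff_smul_eq_zero hint.locallyIntegrable
  intro φ hφ _
  by_contra hne
  have hpos : 0 < ‖∫ x, φ x • h x‖ := norm_pos_iff.2 hne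
  set I := ∫ x, ‖h x‖ with hI
  have hI0 : 0 ≤ I := integral_nonneg fun _ => norm_nonneg _
  set N := ‖∫ x, φ x • h x‖ with hN
  have hε : 0 < N / (I + 1) := by positivity
  obtain ⟨q, hqA, hq⟩ :=
    ContinuousMap.exists_mem_subalgebra_near_continuous_of_isCompact_of_separatesPoints
      hsep ⟨φ, hφ.continuous⟩ hs hε
  have h1 : ∫ x, (φ x - q x) • h x = ∫ x, φ x • h x := by
    simp only [sub_smul]
    rw [integral_sub (radon_int_mul h hint hs φ hφ.continuous)
      (radon_int_mul h hint hs q q.continuous), hA q hqA, sub_zero]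
  have h2 : N ≤ N / (I + 1) * I := by
    rw [hI, ← integral_const_mul, ← hI]
    conv_lhs => rw [hN, ← h1]
    refine norm_integral_le_of_norm_le (hint.norm.const_mul _) (Filter.Eventually.of_forall ?_)
    intro x
    by_cases hx : x ∈ tsupport h
    · rw [norm_smul, norm_sub_rev]
      exact mul_le_mul_of_nonneg_right (hq x hx).le (norm_nonneg _)
    · simp [image_eq_zero_of_notMem_tsupport hx]
  rw [div_mul_eq_mul_div, le_div_iff₀ (by positivity)] at h2
  nlinarith

/-- **Limited-angle Radon transform uniqueness for compactly supported functions**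
(tomographic ingredient in the proof of Corollary 2 of the paper): if the line integrals
of two integrable compactly supported functions on ℝ² agree for all angles `θ` in a
nonempty open set and almost every offset `s`, then the functions agree almost
everywhere. -/
theorem limited_angle_radon_uniqueness
    (f g : ℝ × ℝ → ℂ)
    (hfint : Integrable f) (hfsupp : HasCompactSupport f)
    (hgint : Integrable g) (hgsupp : HasCompactSupport g)
    (V : Set ℝ) (hV : IsOpen V) (hVne : V.Nonempty)
    (heq : ∀ θ ∈ V, ∀ᵐ s : ℝ,
      (∫ t : ℝ, f (s * Real.cos θ - t * Real.sin θ, s * Real.sin θ + t * Real.cos θ))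
      = ∫ t : ℝ, g (s * Real.cos θ - t * Real.sin θ, s * Real.sin θ + t * Real.cos θ)) :
    f =ᵐ[volume] g := by
  have hint : Integrable (f - g) := hfint.sub hgint
  have hs : HasCompactSupport (f - g) := hfsupp.sub hgsupp
  have hz := radon_zero (f - g) hint hs
    (radon_moments (f - g) hint hs V hV hVne fun θ hθ n =>
      radon_slice (f - g) hint hs θ (radon_sub f g hfint hgint θ (heq θ hθ)) n)
  filter_upwards [hz] with p hp
  exact sub_eq_zero.1 hp
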